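/- Fix a positive odd integer k, and for m, m' ∈ M_θ let E^{−k}_{m,m'} ∈ K be the coefficient of P_θ(m')φ̃ in the expansion of E_{−k}·P_θ(m)φ̃ given by Theorem 3.22. Set l = ε_{−k}(m) and l' = ε_{−k}(m'). Then: (a) if m' = Ẽ_{−k}(m), then E^{−k}_{m,m'} ∈ q^{1−l}(1 + qA_0); (b) if m' ≠ Ẽ_{−k}(m), then ord(E^{−k}_{m,m'}) ≥ −(l + l' − 1)/2; (c) if m' ≠ Ẽ_{−k}(m), l ≤ l' + 1, and ord(E^{−k}_{m,m'}) = −(l + l' − 1)/2, then m ∉ B''. -/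

import Mathlib

noncomputable section
open scoped Classical

/-- The base field `K = ℚ(q)`. -/
abbrev K : Type := RatFunc ℚ

/-- The indeterminate `q`. -/
def q : K := RatFunc.X

/-- The `q`-integer `[n]`. -/
def qint (n : ℤ) : K := (q ^ n - q ^ (-n)) / (q - q⁻¹)

/-- The subring `A_0 ⊂ K` of rational functions regular at `q = 0`. -/
def Azero : Set K := {x : K | Polynomial.eval 0 x.denom ≠ 0}

/-- `ord(a) ≥ r`, where `ord(a) = sup{n ∈ ℤ : a ∈ qⁿA_0}` (`ord 0 = ∞`). -/
def ordGE (a : K) (r : ℝ) : Prop := ∃ n : ℤ, r ≤ (n : ℝ) ∧ q ^ (-n) * a ∈ Azero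

/-- `ord(a) > r`. -/
def ordGT (a : K) (r : ℝ) : Prop := ∃ n : ℤ, r < (n : ℝ) ∧ q ^ (-n) * a ∈ Azero

/-- `ord(a) = r`. -/
def ordEQ (a : K) (r : ℝ) : Prop := ordGE a r ∧ ¬ ordGT a r

/-- `a ∈ q^l(1 + qA_0)`. -/
def inUnitBall (a : K) (l : ℤ) : Prop := ∃ b ∈ Azero, a = q ^ l * (1 + q * b)

/-- Multisegments as elements of the free abelian group on the segments `⟨i,j⟩`. -/
abbrev MS : Type := (ℤ × ℤ) →₀ ℤ

/-- The segment `⟨i,j⟩` viewed as a multisegment. -/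
def sg (i j : ℤ) : MS := Finsupp.single (i, j) 1

/-- `m` is a θ-restricted multisegment (`m_{i,j} = 0` unless `−j ≤ i ≤ j`, indices odd,
multiplicities nonnegative). -/
def IsTheta (m : MS) : Prop :=
  ∀ i j : ℤ, m (i, j) ≠ 0 → Odd i ∧ Odd j ∧ -j ≤ i ∧ i ≤ j ∧ 0 < m (i, j)

/-- `A_j^{(−k)}(m)` for a positive odd integer `k`. -/
def Aneg (k : ℤ) (m : MS) (j : ℤ) : ℤ :=
  if k < j then ∑ᶠ l : ℤ, if Odd l ∧ j ≤ l then m (-k, l) - m (-k + 2, l + 2) else 0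
  else if j = k then
    (∑ᶠ l : ℤ, if Odd l ∧ k < l then m (-k, l) - m (-k + 2, l) else 0)
      + 2 * m (-k, k) + (if Odd (m (-k + 2, k)) then 1 else 0)
  else
    (∑ᶠ l : ℤ, if Odd l ∧ k < l then m (-k, l) - m (-k + 2, l) else 0)
      + 2 * m (-k, k) - 2 * m (-k + 2, k - 2)
      + (∑ᶠ i : ℤ, if Odd i ∧ -k + 2 < i ∧ i ≤ j + 2 then m (i, k) else 0)
      - (∑ᶠ i : ℤ, if Odd i ∧ -k + 2 < i ∧ i ≤ j then m (i, k - 2) else 0)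

/-- `ε_{−k}(m) = max{A_j^{(−k)}(m) : j ≥ −k+2}`. -/
def epsNeg (k : ℤ) (m : MS) : ℤ :=
  sSup ((fun j => Aneg k m j) '' {j : ℤ | Odd j ∧ -k + 2 ≤ j})

/-- The rank function realizing the ordering `⋯ > k+2 > k > −k+2 > −k+4 > ⋯ > k−2`
on indices: `j` is larger in this ordering iff `rho k j` is larger in `ℤ`. -/
def rho (k j : ℤ) : ℤ := if k ≤ j then j else -j

/-- The index `n_f`: the smallest index (in the ordering above) attaining `ε_{−k}(m)`. -/
def nfIdx (k : ℤ) (m : MS) : ℤ :=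
  let r := sInf (rho k '' {j : ℤ | Odd j ∧ -k + 2 ≤ j ∧ Aneg k m j = epsNeg k m})
  if k ≤ r then r else -r

/-- The index `n_e`: the largest index (in the ordering above) attaining `ε_{−k}(m)`. -/
def neIdx (k : ℤ) (m : MS) : ℤ :=
  let r := sSup (rho k '' {j : ℤ | Odd j ∧ -k + 2 ≤ j ∧ Aneg k m j = epsNeg k m})
  if k ≤ r then r else -r

/-- The crystal operator `F̃_{−k}` of Definition 4.1. -/
def FtilNeg (k : ℤ) (m : MS) : MS :=
  if k < nfIdx k m then m - sg (-k + 2) (nfIdx k m) + sg (-k) (nfIdx k m)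
  else if nfIdx k m = k then
    (if Odd (m (-k + 2, k)) then m - sg (-k + 2) k + sg (-k) k
     else m - (if k ≠ 1 then sg (-k + 2) (k - 2) else 0) + sg (-k + 2) k)
  else m - (if nfIdx k m ≠ k - 2 then sg (nfIdx k m + 2) (k - 2) else 0) + sg (nfIdx k m + 2) k

/-- The crystal operator `Ẽ_{−k}` of Definition 4.1 (`none` stands for `0`). -/
def EtilNeg (k : ℤ) (m : MS) : Option MS :=
  if epsNeg k m = 0 then none
  else some (if k < neIdx k m then m - sg (-k) (neIdx k m) + sg (-k + 2) (neIdx k m)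
    else if neIdx k m = k then
      (if Odd (m (-k + 2, k)) then
        m - sg (-k + 2) k + (if k ≠ 1 then sg (-k + 2) (k - 2) else 0)
       else m - sg (-k) k + sg (-k + 2) k)
    else m - sg (neIdx k m + 2) k + (if neIdx k m ≠ k - 2 then sg (neIdx k m + 2) (k - 2) else 0))

/-- `n`-th iterate of `Ẽ_{−k}` (with `0 ↦ 0`). -/
def EtilNegIter (k : ℤ) (n : ℕ) (m : MS) : Option MS :=
  (fun o => Option.bind o (EtilNeg k))^[n] (some m)

/-- `A_j^{(k)}(m)` for a positive odd integer `k` and `j ≥ k` (Definition 3.7). -/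
def Apos (k : ℤ) (m : MS) (j : ℤ) : ℤ :=
  ∑ᶠ l : ℤ, if Odd l ∧ j ≤ l then m (k, l) - m (k + 2, l + 2) else 0

/-- `ε_k(m) = max{A_j^{(k)}(m) : j ≥ k}` for `k > 0`. -/
def epsPos (k : ℤ) (m : MS) : ℤ :=
  sSup ((fun j => Apos k m j) '' {j : ℤ | Odd j ∧ k ≤ j})

/-- The smallest `j ≥ k` attaining `ε_k(m)`. -/
def jfIdx (k : ℤ) (m : MS) : ℤ := sInf {j : ℤ | Odd j ∧ k ≤ j ∧ Apos k m j = epsPos k m}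

/-- The largest `j ≥ k` attaining `ε_k(m)`. -/
def jeIdx (k : ℤ) (m : MS) : ℤ := sSup {j : ℤ | Odd j ∧ k ≤ j ∧ Apos k m j = epsPos k m}

/-- The crystal operator `F̃_k` for `k > 0`. -/
def FtilPos (k : ℤ) (m : MS) : MS :=
  m - (if jfIdx k m ≠ k then sg (k + 2) (jfIdx k m) else 0) + sg k (jfIdx k m)

/-- The crystal operator `Ẽ_k` for `k > 0` (`none` stands for `0`). -/
def EtilPos (k : ℤ) (m : MS) : Option MS :=
  if epsPos k m = 0 then none
  else some (m - sg k (jeIdx k m) + (if jeIdx k m ≠ k then sg (k + 2) (jeIdx k m) else 0))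

/-- `ε_k(m)` for any odd `k`. -/
def eps (k : ℤ) (m : MS) : ℤ := if 0 < k then epsPos k m else epsNeg (-k) m

/-- The crystal operator `F̃_k` for any odd `k`. -/
def Ftil (k : ℤ) (m : MS) : MS := if 0 < k then FtilPos k m else FtilNeg (-k) m

/-- The crystal operator `Ẽ_k` for any odd `k`. -/
def Etil (k : ℤ) (m : MS) : Option MS := if 0 < k then EtilPos k m else EtilNeg (-k) m

/-- `n`-th iterate of `Ẽ_k` (with `0 ↦ 0`). -/
def EtilIter (k : ℤ) (n : ℕ) (m : MS) : Option MS :=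
  (fun o => Option.bind o (Etil k))^[n] (some m)


/-- The coefficient `E^{−k}_{m,m'}` of `P_θ(m')φ̃` in the expansion of
`E_{−k}·P_θ(m)φ̃` given by Theorem 3.22 of Enomoto–Kashiwara. -/
def Eco (k : ℤ) (m m' : MS) : K :=
  (∑ᶠ l : ℤ, if Odd l ∧ k < l ∧ m' = m - sg (-k) l + sg (-k + 2) l then
      (1 - q ^ 2) * qint (m (-k + 2, l) + 1) *
        q ^ (1 + ∑ᶠ l' : ℤ, if Odd l' ∧ l ≤ l' then m (-k + 2, l') - m (-k, l') else 0)
    else 0)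
  + (if m' = m - sg (-k) k + sg (-k + 2) k then
      (1 - q ^ 2) * qint (m (-k + 2, k) + 1) *
        q ^ (1 + (∑ᶠ l' : ℤ, if Odd l' ∧ k < l' then m (-k + 2, l') - m (-k, l') else 0)
             + m (-k + 2, k) - 2 * m (-k, k))
     else 0)
  + (∑ᶠ i : ℤ, if Odd i ∧ -k + 2 < i ∧ i ≤ k - 2 ∧ m' = m - sg i k + sg i (k - 2) then
      (1 - q ^ 2) * qint (m (i, k - 2) + 1) *
        q ^ (1 + (∑ᶠ l' : ℤ, if Odd l' ∧ k < l' then m (-k + 2, l') - m (-k, l') else 0)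
             + 2 * m (-k + 2, k - 2) - 2 * m (-k, k)
             + (∑ᶠ i' : ℤ, if Odd i' ∧ -k + 2 < i' ∧ i' ≤ i then
                  m (i', k - 2) - m (i', k) else 0))
    else 0)
  + (if k ≠ 1 ∧ m' = m - sg (-k + 2) k + sg (-k + 2) (k - 2) then
      (1 - q ^ 2) * qint (2 * (m (-k + 2, k - 2) + 1)) *
        q ^ (1 + (∑ᶠ l' : ℤ, if Odd l' ∧ k < l' then m (-k + 2, l') - m (-k, l') else 0)
             + 2 * m (-k + 2, k - 2) - 2 * m (-k, k))
     else 0)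
  + (if m' = m - sg k k then
      q ^ ((∑ᶠ l' : ℤ, if Odd l' ∧ k < l' then m (-k + 2, l') - m (-k, l') else 0)
           - 2 * m (-k, k)
           + (if k ≠ 1 then
               1 - m (k, k) + 2 * m (-k + 2, k - 2)
               + (∑ᶠ i : ℤ, if Odd i ∧ -k + 2 < i ∧ i ≤ k - 2 then
                    m (i, k - 2) - m (i, k) else 0)
              else 0))
     else 0)

/-- The subset `B'' ⊆ M_θ`: those `m` with `n_e(m) ∈ {−k+2, …, k−2}` (in particular
`ε_{−k}(m) ≠ 0`) or with `m_{−k+2,k}` odd. -/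
def Bpp (k : ℤ) : Set MS :=
  {m : MS | IsTheta m ∧
    ((epsNeg k m ≠ 0 ∧ -k + 2 ≤ neIdx k m ∧ neIdx k m ≤ k - 2) ∨ Odd (m (-k + 2, k)))}

/-- The sum of the multiplicities `m_{a,l}` over the `l` satisfying `P`. -/
def rowSum (a : ℤ) (P : ℤ → Prop) (m : MS) : ℤ := ∑ᶠ l : ℤ, if P l then m (a, l) else 0

/-- The sum of the multiplicities `m_{i,b}` over the `i` satisfying `P`. -/
def colSum (b : ℤ) (P : ℤ → Prop) (m : MS) : ℤ := ∑ᶠ i : ℤ, if P i then m (i, b) else 0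

lemma finite_support_ite_comp (g : ℤ → ℤ × ℤ) (hg : g.Injective) (P : ℤ → Prop)
    [DecidablePred P] (m : MS) :
    (Function.support fun l => if P l then m (g l) else 0).Finite := by
  refine (m.hasFiniteSupport.preimage hg.injOn).subset ?_
  intro l hl
  simp only [Function.mem_support, Set.mem_preimage] at hl ⊢
  intro h
  simp [h] at hl

lemma row_injective (a : ℤ) : Function.Injective fun l : ℤ => (a, l) :=
  fun _ _ h => (Prod.mk.inj h).2

lemma col_injective (b : ℤ) : Function.Injective fun i : ℤ => (i, b) :=
  fun _ _ h => (Prod.mk.inj h).1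

lemma rowSum_def (a : ℤ) (P : ℤ → Prop) [DecidablePred P] (m : MS) :
    (∑ᶠ l : ℤ, if P l then m (a, l) else 0) = rowSum a P m := by
  rw [rowSum]
  exact finsum_congr fun l => by congr

lemma colSum_def (b : ℤ) (P : ℤ → Prop) [DecidablePred P] (m : MS) :
    (∑ᶠ i : ℤ, if P i then m (i, b) else 0) = colSum b P m := by
  rw [colSum]
  exact finsum_congr fun l => by congr

lemma rowSum_sub_rowSum (a b : ℤ) (P : ℤ → Prop) [DecidablePred P] (m : MS) :
    (∑ᶠ l : ℤ, if P l then m (a, l) - m (b, l) else 0) = rowSum a P m - rowSum b P m := by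
  rw [← rowSum_def a P m, ← rowSum_def b P m,
    ← finsum_sub_distrib (finite_support_ite_comp _ (row_injective a) P m)
    (finite_support_ite_comp _ (row_injective b) P m)]
  refine finsum_congr fun l => ?_
  split_ifs <;> simp

lemma colSum_sub_colSum (a b : ℤ) (P : ℤ → Prop) [DecidablePred P] (m : MS) :
    (∑ᶠ i : ℤ, if P i then m (i, a) - m (i, b) else 0) = colSum a P m - colSum b P m := by
  rw [← colSum_def a P m, ← colSum_def b P m,
    ← finsum_sub_distrib (finite_support_ite_comp _ (col_injective a) P m)
    (finite_support_ite_comp _ (col_injective b) P m)]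
  refine finsum_congr fun l => ?_
  split_ifs <;> simp

lemma rowSum_add (a : ℤ) (P : ℤ → Prop) (m n : MS) :
    rowSum a P (m + n) = rowSum a P m + rowSum a P n := by
  rw [rowSum, rowSum, rowSum, ← finsum_add_distrib
    (finite_support_ite_comp _ (row_injective a) P m)
    (finite_support_ite_comp _ (row_injective a) P n)]
  refine finsum_congr fun l => ?_
  split_ifs <;> simp

lemma rowSum_sub (a : ℤ) (P : ℤ → Prop) (m n : MS) :
    rowSum a P (m - n) = rowSum a P m - rowSum a P n := by
  have h := rowSum_add a P (m - n) n
  rw [sub_add_cancel] at h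
  omega

lemma rowSum_sg (a : ℤ) (P : ℤ → Prop) (c d : ℤ) :
    rowSum a P (sg c d) = if c = a ∧ P d then 1 else 0 := by
  rw [rowSum, finsum_eq_single _ d]
  · by_cases h : c = a <;> simp [sg, h]
  · intro l hl
    simp [sg, hl.symm]

lemma colSum_add (b : ℤ) (P : ℤ → Prop) (m n : MS) :
    colSum b P (m + n) = colSum b P m + colSum b P n := by
  rw [colSum, colSum, colSum, ← finsum_add_distrib
    (finite_support_ite_comp _ (col_injective b) P m)
    (finite_support_ite_comp _ (col_injective b) P n)]
  refine finsum_congr fun l => ?_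
  split_ifs <;> simp

lemma colSum_sub (b : ℤ) (P : ℤ → Prop) (m n : MS) :
    colSum b P (m - n) = colSum b P m - colSum b P n := by
  have h := colSum_add b P (m - n) n
  rw [sub_add_cancel] at h
  omega

lemma colSum_sg (b : ℤ) (P : ℤ → Prop) (c d : ℤ) :
    colSum b P (sg c d) = if d = b ∧ P c then 1 else 0 := by
  rw [colSum, finsum_eq_single _ c]
  · by_cases h : d = b <;> simp [sg, h]
  · intro l hl
    simp [sg, hl.symm]

lemma finsum_ite_split (f : ℤ → ℤ) (P Q : ℤ → Prop) [DecidablePred P] [DecidablePred Q] (c : ℤ)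
    (hPQ : ∀ l, P l ↔ Q l ∨ l = c) (hc : ¬ Q c)
    (hf : (Function.support fun l => if Q l then f l else 0).Finite) :
    (∑ᶠ l, if P l then f l else 0) = (∑ᶠ l, if Q l then f l else 0) + f c := by
  have h1 : (∑ᶠ l : ℤ, if l = c then f l else 0) = f c := by
    rw [finsum_eq_single _ c (fun l hl => by simp [hl])]
    simp
  rw [← h1, ← finsum_add_distrib hf]
  · refine finsum_congr fun l => ?_
    by_cases hl : l = c
    · subst hl; simp [hPQ, hc]
    · simp [hPQ, hl]
  · refine (Set.finite_singleton c).subset fun l hl => ?_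
    by_contra h
    simp_all

lemma rowSum_split (a : ℤ) (m : MS) (P Q : ℤ → Prop) (c : ℤ)
    (hPQ : ∀ l, P l ↔ Q l ∨ l = c) (hc : ¬ Q c) :
    rowSum a P m = rowSum a Q m + m (a, c) :=
  finsum_ite_split (fun l => m (a, l)) P Q c hPQ hc
    (finite_support_ite_comp _ (row_injective a) Q m)

lemma colSum_split (b : ℤ) (m : MS) (P Q : ℤ → Prop) (c : ℤ)
    (hPQ : ∀ l, P l ↔ Q l ∨ l = c) (hc : ¬ Q c) :
    colSum b P m = colSum b Q m + m (c, b) :=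
  finsum_ite_split (fun l => m (l, b)) P Q c hPQ hc
    (finite_support_ite_comp _ (col_injective b) Q m)

lemma exists_forall_lt_eq_zero (m : MS) : ∃ N : ℤ, ∀ a l : ℤ, N < l → m (a, l) = 0 := by
  obtain ⟨N, hN⟩ := (m.support.image Prod.snd).bddAbove
  refine ⟨N, fun a l hl => ?_⟩
  by_contra h
  have : l ≤ N := hN (by
    simp only [Finset.coe_image, Set.mem_image, Finset.mem_coe, Finsupp.mem_support_iff]
    exact ⟨(a, l), h, rfl⟩)
  omega

lemma Aneg_of_gt {k j : ℤ} (hj : Odd j) (h : k < j) (m : MS) :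
    Aneg k m j = rowSum (-k) (fun l => Odd l ∧ j ≤ l) m
      - rowSum (-k + 2) (fun l => Odd l ∧ j < l) m := by
  have hshift : rowSum (-k + 2) (fun l => Odd l ∧ j < l) m
      = ∑ᶠ l : ℤ, if Odd l ∧ j ≤ l then m (-k + 2, l + 2) else 0 := by
    rw [rowSum, ← finsum_comp_equiv (Equiv.addRight (2 : ℤ))]
    refine finsum_congr fun l => ?_
    have : (Odd (l + 2) ∧ j < l + 2) ↔ (Odd l ∧ j ≤ l) := by
      simp only [Int.odd_iff] at *; omega
    simp only [Equiv.coe_addRight]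
    by_cases hl : Odd l ∧ j ≤ l
    · exact (if_pos (this.2 hl)).trans (if_pos hl).symm
    · exact (if_neg (mt this.1 hl)).trans (if_neg hl).symm
  rw [Aneg, if_pos h, hshift, ← rowSum_def (-k), ← finsum_sub_distrib]
  · refine finsum_congr fun l => ?_
    split_ifs <;> simp
  · exact finite_support_ite_comp _ (row_injective (-k)) _ m
  · exact finite_support_ite_comp (fun l => (-k + 2, l + 2))
      (fun _ _ h => by simpa using h) _ m

lemma Aneg_self (k : ℤ) (m : MS) :
    Aneg k m k = rowSum (-k) (fun l => Odd l ∧ k < l) m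
      - rowSum (-k + 2) (fun l => Odd l ∧ k < l) m
      + 2 * m (-k, k) + (if Odd (m (-k + 2, k)) then 1 else 0) := by
  rw [Aneg, if_neg (lt_irrefl _), if_pos rfl, rowSum_sub_rowSum]

lemma Aneg_of_lt {k j : ℤ} (h : j < k) (m : MS) :
    Aneg k m j = rowSum (-k) (fun l => Odd l ∧ k < l) m
      - rowSum (-k + 2) (fun l => Odd l ∧ k < l) m
      + 2 * m (-k, k) - 2 * m (-k + 2, k - 2)
      + colSum k (fun i => Odd i ∧ -k + 2 < i ∧ i ≤ j + 2) m
      - colSum (k - 2) (fun i => Odd i ∧ -k + 2 < i ∧ i ≤ j) m := by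
  rw [Aneg, if_neg (by omega), if_neg (by omega), rowSum_sub_rowSum, colSum_def, colSum_def]

lemma exists_forall_Aneg_eq_zero (k : ℤ) (m : MS) :
    ∃ N : ℤ, k < N ∧ ∀ j, N < j → Aneg k m j = 0 := by
  obtain ⟨N, hN⟩ := exists_forall_lt_eq_zero m
  refine ⟨max N (k + 1), by omega, fun j hj => ?_⟩
  rw [Aneg, if_pos (by omega)]
  refine finsum_eq_zero_of_forall_eq_zero fun l => ?_
  split_ifs with h
  · rw [hN _ _ (by omega), hN _ _ (by omega), sub_zero]
  · rfl

lemma bddAbove_Aneg (k : ℤ) (m : MS) :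
    BddAbove ((fun j => Aneg k m j) '' {j : ℤ | Odd j ∧ -k + 2 ≤ j}) := by
  obtain ⟨N, -, hN⟩ := exists_forall_Aneg_eq_zero k m
  refine (((Set.finite_Icc (-k + 2) N).image (Aneg k m)).union
    (Set.finite_singleton 0)).bddAbove.mono ?_
  rintro _ ⟨j, ⟨-, hj⟩, rfl⟩
  by_cases h : j ≤ N
  · exact Or.inl ⟨j, ⟨hj, h⟩, rfl⟩
  · exact Or.inr (hN j (by omega))

lemma Aneg_le_epsNeg {k j : ℤ} (m : MS) (hj : Odd j) (h : -k + 2 ≤ j) :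
    Aneg k m j ≤ epsNeg k m :=
  le_csSup (bddAbove_Aneg k m) ⟨j, ⟨hj, h⟩, rfl⟩

lemma epsNeg_nonneg (k : ℤ) (m : MS) : 0 ≤ epsNeg k m := by
  obtain ⟨N, -, hN⟩ := exists_forall_Aneg_eq_zero k m
  have hodd : Odd (2 * (|N| + |k| + 1) + 1) := ⟨_, rfl⟩
  have h := Aneg_le_epsNeg (k := k) m hodd (by
    have := neg_abs_le k; have := abs_nonneg N; have := abs_nonneg k; omega)
  rwa [hN _ (by have := le_abs_self N; have := abs_nonneg N; have := abs_nonneg k; omega)] at h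

lemma rho_of_le {k j : ℤ} (h : k ≤ j) : rho k j = j := if_pos h

lemma rho_of_lt {k j : ℤ} (h : j < k) : rho k j = -j := if_neg (by omega)

lemma rho_injOn {k i j : ℤ} (hi : -k + 2 ≤ i) (hj : -k + 2 ≤ j) (h : rho k i = rho k j) :
    i = j := by
  unfold rho at h
  split_ifs at h <;> omega

lemma neIdx_spec {k : ℤ} (hk : Odd k) (hkpos : 0 < k) {m : MS} (h0 : epsNeg k m ≠ 0) :
    Odd (neIdx k m) ∧ -k + 2 ≤ neIdx k m ∧ Aneg k m (neIdx k m) = epsNeg k m ∧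
      ∀ j, Odd j → -k + 2 ≤ j → Aneg k m j = epsNeg k m → rho k j ≤ rho k (neIdx k m) := by
  set S := {j : ℤ | Odd j ∧ -k + 2 ≤ j ∧ Aneg k m j = epsNeg k m} with hS
  have hne : (rho k '' S).Nonempty := by
    obtain ⟨j, hj, hj'⟩ := Int.csSup_mem
      (s := (fun j => Aneg k m j) '' {j : ℤ | Odd j ∧ -k + 2 ≤ j})
      ⟨_, k, ⟨hk, by simp only [Int.odd_iff] at hk; omega⟩, rfl⟩ (bddAbove_Aneg k m)
    exact ⟨_, j, ⟨hj.1, hj.2, hj'⟩, rfl⟩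
  have hbdd : BddAbove (rho k '' S) := by
    obtain ⟨N, hkN, hN⟩ := exists_forall_Aneg_eq_zero k m
    refine ⟨N, ?_⟩
    rintro _ ⟨j, ⟨-, hj, hA⟩, rfl⟩
    have : j ≤ N := by
      by_contra h
      exact h0 (by rw [← hA, hN j (by omega)])
    unfold rho
    split_ifs <;> omega
  obtain ⟨n, hn, hn'⟩ := Int.csSup_mem hne hbdd
  have hne_eq : neIdx k m = n := by
    have h1 := hn.2.1
    simp only [neIdx, ← hS, ← hn']
    unfold rho
    split_ifs <;> omega
  rw [hne_eq]
  refine ⟨hn.1, hn.2.1, hn.2.2, fun j h1 h2 h3 => ?_⟩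
  rw [hn']
  exact le_csSup hbdd ⟨j, ⟨h1, h2, h3⟩, rfl⟩

/-- The multisegment obtained from `m` by the rule of `Ẽ_{−k}` at the index `j`. -/
def lowerAt (k : ℤ) (m : MS) (j : ℤ) : MS :=
  if k < j then m - sg (-k) j + sg (-k + 2) j
  else if j = k then
    (if Odd (m (-k + 2, k)) then
      m - sg (-k + 2) k + (if k ≠ 1 then sg (-k + 2) (k - 2) else 0)
     else m - sg (-k) k + sg (-k + 2) k)
  else m - sg (j + 2) k + (if j ≠ k - 2 then sg (j + 2) (k - 2) else 0)

lemma EtilNeg_eq_lowerAt (k : ℤ) (m : MS) :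
    EtilNeg k m = if epsNeg k m = 0 then none else some (lowerAt k m (neIdx k m)) := rfl

lemma sg_apply (a b c d : ℤ) : sg a b (c, d) = if a = c ∧ b = d then 1 else 0 := by
  simp [sg, Finsupp.single_apply]

lemma rowSum_zero (a : ℤ) (P : ℤ → Prop) : rowSum a P 0 = 0 := by simp [rowSum]

lemma colSum_zero (b : ℤ) (P : ℤ → Prop) : colSum b P 0 = 0 := by simp [colSum]

lemma Aneg_lowerAt {k j : ℤ} (hk : Odd k) (hkpos : 0 < k) (m : MS) (hj : Odd j)
    (hkj : -k + 2 ≤ j) : Aneg k (lowerAt k m j) j = Aneg k m j - 1 := by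
  rcases lt_trichotomy k j with h | rfl | h
  · rw [lowerAt, if_pos h, Aneg_of_gt hj h, Aneg_of_gt hj h]
    simp only [rowSum_add, rowSum_sub, rowSum_sg]
    simp [hj, show -k + 2 ≠ -k by omega]
    ring
  · rw [lowerAt, if_neg (lt_irrefl _), if_pos rfl, Aneg_self, Aneg_self]
    by_cases ho : Odd (m (-k + 2, k))
    · rw [if_pos ho]
      by_cases h1 : k = 1
      · subst h1
        simp_all [rowSum_sub, rowSum_sg, sg_apply]
      · simp_all [rowSum_add, rowSum_sub, rowSum_sg, sg_apply]
        grind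
    · rw [if_neg ho]
      simp_all [rowSum_add, rowSum_sub, rowSum_sg, sg_apply]
      grind
  · rw [lowerAt, if_neg (by omega), if_neg (by omega), Aneg_of_lt h, Aneg_of_lt h]
    by_cases h1 : j = k - 2
    · simp_all [rowSum_sub, rowSum_sg, sg_apply, colSum_sub, colSum_sg]
      grind
    · simp_all [rowSum_add, rowSum_sub, rowSum_sg, sg_apply, colSum_add, colSum_sub, colSum_sg]
      grind

lemma Aneg_lowerAt_of_rho_lt {k j n : ℤ} (hk : Odd k) (m : MS) (hj : Odd j)
    (hkj : -k + 2 ≤ j) (hn : Odd n) (hkn : -k + 2 ≤ n) (hjn : rho k j < rho k n) :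
    Aneg k (lowerAt k m j) n = Aneg k m n := by
  rcases lt_trichotomy k j with h | rfl | h
  · have h2 : k < n := by unfold rho at hjn; split_ifs at hjn <;> omega
    rw [rho_of_le h.le, rho_of_le h2.le] at hjn
    rw [lowerAt, if_pos h, Aneg_of_gt hn h2, Aneg_of_gt hn h2]
    simp only [rowSum_add, rowSum_sub, rowSum_sg]
    grind
  · have h2 : k < n := by unfold rho at hjn; split_ifs at hjn <;> omega
    rw [lowerAt, if_neg (lt_irrefl _), if_pos rfl, Aneg_of_gt hn h2, Aneg_of_gt hn h2]
    split_ifs <;> simp only [rowSum_add, rowSum_sub, rowSum_sg, rowSum_zero] <;> grind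
  · rw [lowerAt, if_neg (by omega), if_neg (by omega)]
    rcases lt_trichotomy k n with h2 | rfl | h2
    · rw [Aneg_of_gt hn h2, Aneg_of_gt hn h2]
      split_ifs <;> simp only [rowSum_add, rowSum_sub, rowSum_sg, rowSum_zero] <;> grind
    · rw [Aneg_self, Aneg_self]
      have h3 : ¬ (j + 2 = -k + 2) := by grind
      split_ifs <;> simp_all [rowSum_add, rowSum_sub, rowSum_sg, sg_apply] <;> grind
    · rw [rho_of_lt h, rho_of_lt h2] at hjn
      rw [Aneg_of_lt h2, Aneg_of_lt h2]
      split_ifs <;> simp only [rowSum_add, rowSum_sub, rowSum_sg, rowSum_zero, colSum_add,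
        colSum_sub, colSum_sg, colSum_zero, sg_apply, Finsupp.add_apply, Finsupp.sub_apply,
        Finsupp.coe_zero, Pi.zero_apply] <;> grind

lemma algebraMap_mem_Azero (p : Polynomial ℚ) : algebraMap (Polynomial ℚ) K p ∈ Azero := by
  simp [Azero, RatFunc.denom_algebraMap]

lemma q_ne_zero : q ≠ 0 := RatFunc.X_ne_zero

lemma algebraMap_X_eq_q : algebraMap (Polynomial ℚ) K Polynomial.X = q := RatFunc.algebraMap_X

/-- `a ∈ q^o(1 + qℚ[q])`. -/
def HasLeadExp (a : K) (o : ℤ) : Prop :=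
  ∃ p : Polynomial ℚ, a = q ^ o * (1 + q * algebraMap (Polynomial ℚ) K p)

lemma HasLeadExp.inUnitBall {a : K} {o : ℤ} (h : HasLeadExp a o) : inUnitBall a o := by
  obtain ⟨p, rfl⟩ := h
  exact ⟨_, algebraMap_mem_Azero p, rfl⟩

lemma HasLeadExp.mem_Azero {a : K} {o : ℤ} (h : HasLeadExp a o) : q ^ (-o) * a ∈ Azero := by
  obtain ⟨p, rfl⟩ := h
  rw [← mul_assoc, ← zpow_add₀ q_ne_zero, neg_add_cancel, zpow_zero, one_mul,
    ← algebraMap_X_eq_q, ← map_mul, ← map_one (algebraMap (Polynomial ℚ) K), ← map_add]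
  exact algebraMap_mem_Azero _

lemma hasLeadExp_zpow (o : ℤ) : HasLeadExp (q ^ o) o := ⟨0, by simp⟩

lemma one_sub_q_sq_ne_zero : (1 : K) - q ^ 2 ≠ 0 := by
  rw [← algebraMap_X_eq_q, ← map_one (algebraMap (Polynomial ℚ) K), ← map_pow, ← map_sub]
  refine (map_ne_zero_iff _ (RatFunc.algebraMap_injective ℚ)).2 fun h => ?_
  have := congrArg (Polynomial.eval 0) h
  simp at this

lemma one_sub_q_sq_mul_qint (n : ℤ) : (1 - q ^ 2) * qint n = q ^ (1 - n) * (1 - q ^ (2 * n)) := by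
  have h0 := q_ne_zero
  have h1 : q - q⁻¹ ≠ 0 := by
    intro h
    apply one_sub_q_sq_ne_zero
    field_simp at h
    linear_combination -h
  have h2 : q ^ (1 - n) = q * q ^ (-n) := by rw [sub_eq_add_neg, zpow_add₀ h0, zpow_one]
  have h3 : q ^ (-n) * q ^ (2 * n) = q ^ n := by rw [← zpow_add₀ h0]; congr 1; ring
  have h4 : (1 - q ^ 2) = -(q * (q - q⁻¹)) := by field_simp; ring
  rw [qint, h2, h4, mul_div_assoc', div_eq_iff h1]
  linear_combination (q * (q - q⁻¹)) * h3

lemma hasLeadExp_qint {n : ℤ} (hn : 0 < n) (e : ℤ) :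
    HasLeadExp ((1 - q ^ 2) * qint n * q ^ e) (e + 1 - n) := by
  refine ⟨-Polynomial.X ^ (2 * n - 1).toNat, ?_⟩
  have h : q * q ^ (2 * n - 1).toNat = q ^ (2 * n) := by
    rw [← zpow_natCast, Int.toNat_of_nonneg (by omega), ← zpow_one_add₀ q_ne_zero]
    congr 1; ring
  rw [one_sub_q_sq_mul_qint, map_neg, map_pow, algebraMap_X_eq_q, mul_neg, h, mul_right_comm,
    ← zpow_add₀ q_ne_zero, ← sub_eq_add_neg]
  congr 2; ring

/-- `⟨a,b⟩` is the only segment whose multiplicity decreases from `m` to `m'`. -/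
def IsRemoved (m m' : MS) (a b : ℤ) : Prop := ∀ c d, m' (c, d) < m (c, d) ↔ c = a ∧ d = b

lemma IsRemoved.unique {m m' : MS} {a b c d : ℤ} (h : IsRemoved m m' a b)
    (h' : IsRemoved m m' c d) : a = c ∧ b = d :=
  (h' a b).1 ((h a b).2 ⟨rfl, rfl⟩)

lemma isRemoved_sub_add {m m' : MS} {a b c d : ℤ} (h : m' = m - sg a b + sg c d)
    (hne : ¬ (a = c ∧ b = d)) : IsRemoved m m' a b := by
  intro x y
  subst h
  simp only [Finsupp.add_apply, Finsupp.sub_apply, sg_apply]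
  grind

lemma isRemoved_sub {m m' : MS} {a b : ℤ} (h : m' = m - sg a b) : IsRemoved m m' a b := by
  intro x y
  subst h
  simp only [Finsupp.sub_apply, sg_apply]
  grind

lemma finsum_ite_unique (P : ℤ → Prop) [DecidablePred P] (f : ℤ → K) {c : ℤ} (hc : P c)
    (h : ∀ l, P l → l = c) : (∑ᶠ l, if P l then f l else 0) = f c := by
  rw [finsum_eq_single _ c fun l hl => if_neg fun hP => hl (h l hP), if_pos hc]

lemma finsum_ite_false (P : ℤ → Prop) [DecidablePred P] (f : ℤ → K) (h : ∀ l, ¬ P l) :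
    (∑ᶠ l, if P l then f l else 0) = 0 :=
  finsum_eq_zero_of_forall_eq_zero fun l => if_neg (h l)

section Coefficients

variable {k : ℤ} {m m' : MS}

lemma hasLeadExp_Eco_of_gt (hkpos : 0 < k) (hm : ∀ p, 0 ≤ m p) {l : ℤ} (hl : Odd l) (hkl : k < l)
    (h : m' = m - sg (-k) l + sg (-k + 2) l) : HasLeadExp (Eco k m m') (1 - Aneg k m l) := by
  have hr := isRemoved_sub_add h (by omega)
  rw [Eco, finsum_ite_unique _ _ (c := l) ⟨hl, hkl, h⟩
      fun x hx => ((isRemoved_sub_add hx.2.2 (by omega)).unique hr).2,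
    if_neg fun h' => by have := (isRemoved_sub_add h' (by omega)).unique hr; omega,
    finsum_ite_false _ _ fun x hx => by
      have := (isRemoved_sub_add hx.2.2.2 (by omega)).unique hr; omega,
    if_neg fun h' => by have := (isRemoved_sub_add h'.2 (by omega)).unique hr; omega,
    if_neg fun h' => by have := (isRemoved_sub h').unique hr; omega]
  simp only [add_zero, rowSum_sub_rowSum]
  convert hasLeadExp_qint (n := m (-k + 2, l) + 1) (by have := hm (-k + 2, l); omega) _ using 1
  rw [Aneg_of_gt hl hkl, rowSum_split (-k + 2) m (fun x => Odd x ∧ l ≤ x) (fun x => Odd x ∧ l < x) l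
    (by grind) (by simp)]
  ring

lemma hasLeadExp_Eco_self (hkpos : 0 < k) (hm : ∀ p, 0 ≤ m p)
    (h : m' = m - sg (-k) k + sg (-k + 2) k) :
    HasLeadExp (Eco k m m') (1 - Aneg k m k + if Odd (m (-k + 2, k)) then 1 else 0) := by
  have hr := isRemoved_sub_add h (by omega)
  rw [Eco, finsum_ite_false _ _ fun x hx => by
      have := (isRemoved_sub_add hx.2.2 (by omega)).unique hr; omega,
    if_pos h,
    finsum_ite_false _ _ fun x hx => by
      have := (isRemoved_sub_add hx.2.2.2 (by omega)).unique hr; omega,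
    if_neg fun h' => by have := (isRemoved_sub_add h'.2 (by omega)).unique hr; omega,
    if_neg fun h' => by have := (isRemoved_sub h').unique hr; omega]
  simp only [add_zero, zero_add, rowSum_sub_rowSum]
  convert hasLeadExp_qint (n := m (-k + 2, k) + 1) (by have := hm (-k + 2, k); omega) _ using 1
  rw [Aneg_self]
  ring

lemma hasLeadExp_Eco_of_lt (hm : ∀ p, 0 ≤ m p) {i : ℤ} (hi : Odd i)
    (hki : -k + 2 < i) (hik : i ≤ k - 2) (h : m' = m - sg i k + sg i (k - 2)) :
    HasLeadExp (Eco k m m') (1 - Aneg k m (i - 2)) := by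
  have hr := isRemoved_sub_add h (by omega)
  rw [Eco, finsum_ite_false _ _ fun x hx => by
      have := (isRemoved_sub_add hx.2.2 (by omega)).unique hr; omega,
    if_neg fun h' => by have := (isRemoved_sub_add h' (by omega)).unique hr; omega,
    finsum_ite_unique _ _ (c := i) ⟨hi, hki, hik, h⟩
      fun x hx => ((isRemoved_sub_add hx.2.2.2 (by omega)).unique hr).1,
    if_neg fun h' => by have := (isRemoved_sub_add h'.2 (by omega)).unique hr; omega,
    if_neg fun h' => by have := (isRemoved_sub h').unique hr; omega]
  simp only [add_zero, zero_add, rowSum_sub_rowSum, colSum_sub_colSum]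
  convert hasLeadExp_qint (n := m (i, k - 2) + 1) (by have := hm (i, k - 2); omega) _ using 1
  rw [Aneg_of_lt (by omega), sub_add_cancel,
    colSum_split (k - 2) m (fun x => Odd x ∧ -k + 2 < x ∧ x ≤ i)
      (fun x => Odd x ∧ -k + 2 < x ∧ x ≤ i - 2) i (by grind) (by grind)]
  ring

lemma hasLeadExp_Eco_sub_two (hk1 : k ≠ 1) (hm : ∀ p, 0 ≤ m p)
    (h : m' = m - sg (-k + 2) k + sg (-k + 2) (k - 2)) :
    HasLeadExp (Eco k m m') (-Aneg k m k + if Odd (m (-k + 2, k)) then 1 else 0) := by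
  have hr := isRemoved_sub_add h (by omega)
  rw [Eco, finsum_ite_false _ _ fun x hx => by
      have := (isRemoved_sub_add hx.2.2 (by omega)).unique hr; omega,
    if_neg fun h' => by have := (isRemoved_sub_add h' (by omega)).unique hr; omega,
    finsum_ite_false _ _ fun x hx => by
      have := (isRemoved_sub_add hx.2.2.2 (by omega)).unique hr; omega,
    if_pos ⟨hk1, h⟩,
    if_neg fun h' => by have := (isRemoved_sub h').unique hr; omega]
  simp only [add_zero, zero_add, rowSum_sub_rowSum]
  convert hasLeadExp_qint (n := 2 * (m (-k + 2, k - 2) + 1))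
    (by have := hm (-k + 2, k - 2); omega) _ using 1
  rw [Aneg_self]
  ring

lemma Eco_of_eq_sub (hkpos : 0 < k) (h : m' = m - sg k k) :
    Eco k m m' = q ^ (rowSum (-k + 2) (fun l => Odd l ∧ k < l) m
      - rowSum (-k) (fun l => Odd l ∧ k < l) m - 2 * m (-k, k)
      + (if k ≠ 1 then 1 - m (k, k) + 2 * m (-k + 2, k - 2)
          + (colSum (k - 2) (fun i => Odd i ∧ -k + 2 < i ∧ i ≤ k - 2) m
            - colSum k (fun i => Odd i ∧ -k + 2 < i ∧ i ≤ k - 2) m) else 0)) := by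
  have hr := isRemoved_sub h
  rw [Eco, finsum_ite_false _ _ fun x hx => by
      have := (isRemoved_sub_add hx.2.2 (by omega)).unique hr; omega,
    if_neg fun h' => by have := (isRemoved_sub_add h' (by omega)).unique hr; omega,
    finsum_ite_false _ _ fun x hx => by
      have := (isRemoved_sub_add hx.2.2.2 (by omega)).unique hr; omega,
    if_neg fun h' => by have := (isRemoved_sub_add h'.2 (by omega)).unique hr; omega,
    if_pos h]
  simp only [zero_add, rowSum_sub_rowSum, colSum_sub_colSum]

lemma hasLeadExp_Eco_last (hk : Odd k) (hkpos : 0 < k) (hk1 : k ≠ 1) (h : m' = m - sg k k) :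
    HasLeadExp (Eco k m m') (1 - Aneg k m (k - 2)) := by
  rw [Eco_of_eq_sub hkpos h, if_pos hk1]
  convert hasLeadExp_zpow _ using 1
  rw [Aneg_of_lt (by omega), sub_add_cancel,
    colSum_split k m (fun x => Odd x ∧ -k + 2 < x ∧ x ≤ k)
      (fun x => Odd x ∧ -k + 2 < x ∧ x ≤ k - 2) k (by grind) (by grind)]
  ring

lemma hasLeadExp_Eco_one (h : m' = m - sg 1 1) :
    HasLeadExp (Eco 1 m m') (-Aneg 1 m 1 + if Odd (m (-1 + 2, 1)) then 1 else 0) := by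
  rw [Eco_of_eq_sub one_pos h, if_neg (by simp)]
  convert hasLeadExp_zpow _ using 1
  rw [Aneg_self]
  ring

lemma hasLeadExp_Eco_flip (hm : ∀ p, 0 ≤ m p)
    (h : m' = m - sg (-k + 2) k + (if k ≠ 1 then sg (-k + 2) (k - 2) else 0)) :
    HasLeadExp (Eco k m m') (-Aneg k m k + if Odd (m (-k + 2, k)) then 1 else 0) := by
  by_cases hk1 : k = 1
  · subst hk1
    exact hasLeadExp_Eco_one (by simpa using h)
  · exact hasLeadExp_Eco_sub_two hk1 hm (by simpa [hk1] using h)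

lemma hasLeadExp_Eco_lowerAt (hk : Odd k) (hkpos : 0 < k) (hm : ∀ p, 0 ≤ m p) {j : ℤ}
    (hj : Odd j) (hkj : -k + 2 ≤ j) :
    HasLeadExp (Eco k m (lowerAt k m j)) (1 - Aneg k m j) := by
  rcases lt_trichotomy k j with h | rfl | h
  · exact hasLeadExp_Eco_of_gt hkpos hm hj h (if_pos h)
  · rw [lowerAt, if_neg (lt_irrefl _), if_pos rfl]
    by_cases ho : Odd (m (-k + 2, k))
    · rw [if_pos ho]
      have := hasLeadExp_Eco_flip (k := k) hm rfl
      rwa [if_pos ho, neg_add_eq_sub (Aneg k m k)] at this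
    · rw [if_neg ho]
      have := hasLeadExp_Eco_self (k := k) hkpos hm rfl
      rwa [if_neg ho, add_zero] at this
  · rw [lowerAt, if_neg (by omega), if_neg (by omega)]
    by_cases hj2 : j = k - 2
    · subst hj2
      exact hasLeadExp_Eco_last hk hkpos (by omega) (by simp)
    · rw [if_pos hj2]
      have : j < k - 2 := by grind
      simpa using hasLeadExp_Eco_of_lt hm (i := j + 2) (by grind) (by omega) (by grind) rfl

lemma Eco_eq_zero_or (hk : Odd k) (hkpos : 0 < k) :
    Eco k m m' = 0 ∨ (∃ j, Odd j ∧ -k + 2 ≤ j ∧ m' = lowerAt k m j) ∨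
      (Odd (m (-k + 2, k)) ∧ m' = m - sg (-k) k + sg (-k + 2) k) ∨
      (¬ Odd (m (-k + 2, k)) ∧
        m' = m - sg (-k + 2) k + (if k ≠ 1 then sg (-k + 2) (k - 2) else 0)) := by
  by_contra! hne
  obtain ⟨h0, hlow, hodd, heven⟩ := hne
  refine h0 ?_
  have hk' : ∀ h : m' = m - sg (-k + 2) k + (if k ≠ 1 then sg (-k + 2) (k - 2) else 0), False := by
    intro h
    by_cases ho : Odd (m (-k + 2, k))
    · exact hlow k hk (by grind) (by rw [lowerAt, if_neg (lt_irrefl _), if_pos rfl, if_pos ho, h])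
    · exact heven (by simpa using ho) h
  rw [Eco, finsum_ite_false _ _ fun l hl => hlow l hl.1 (by omega)
      (by rw [lowerAt, if_pos hl.2.1, hl.2.2]),
    if_neg fun h => ?_, finsum_ite_false _ _ fun i hi => hlow (i - 2) (by grind) (by grind) ?_,
    if_neg fun h => hk' (by rw [if_pos h.1, h.2]), if_neg fun h => ?_]
  · simp
  · by_cases hk1 : k = 1
    · subst hk1
      exact hk' (by simpa using h)
    · refine hlow (k - 2) (by grind) (by grind) ?_
      rw [lowerAt, if_neg (by omega), if_neg (by omega), h]
      simp
  · rw [lowerAt, if_neg (by omega), if_neg (by omega), if_pos (by omega), sub_add_cancel, hi.2.2.2]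
  · by_cases ho : Odd (m (-k + 2, k))
    · exact hodd ho h
    · exact hlow k hk (by grind) (by rw [lowerAt, if_neg (lt_irrefl _), if_pos rfl, if_neg ho, h])

end Coefficients

lemma IsTheta.nonneg {m : MS} (hm : IsTheta m) (p : ℤ × ℤ) : 0 ≤ m p := by
  by_contra h
  exact h (hm p.1 p.2 (by simp only [Prod.mk.eta]; omega)).2.2.2.2.le

lemma ordGT.ordGE {a : K} {r : ℝ} (h : ordGT a r) : ordGE a r := by
  obtain ⟨n, hn, ha⟩ := h
  exact ⟨n, hn.le, ha⟩

lemma ordGT_zero (r : ℝ) : ordGT 0 r := by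
  obtain ⟨n, hn⟩ := exists_int_gt r
  exact ⟨n, hn, by simp [Azero]⟩

lemma HasLeadExp.ordGT {a : K} {o l l' : ℤ} (h : HasLeadExp a o) (hlt : 1 - l - l' < 2 * o) :
    ordGT a (-((l : ℝ) + (l' : ℝ) - 1) / 2) := by
  refine ⟨o, ?_, h.mem_Azero⟩
  have : (1 - (l : ℝ) - l') < 2 * o := by exact_mod_cast hlt
  linarith

section Bounds

variable {k : ℤ} {m m' : MS}

lemma two_mul_Aneg_lt_of_eq_lowerAt (hk : Odd k) (hkpos : 0 < k) {j : ℤ} (hj : Odd j)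
    (hkj : -k + 2 ≤ j) (h : m' = lowerAt k m j) (hne : EtilNeg k m ≠ some m') :
    2 * Aneg k m j - 1 < epsNeg k m + epsNeg k m' := by
  have h1 := Aneg_le_epsNeg m hj hkj
  have h2 := Aneg_le_epsNeg m' hj hkj
  rw [h, Aneg_lowerAt hk hkpos m hj hkj, ← h] at h2
  by_cases h0 : epsNeg k m = 0
  · have := epsNeg_nonneg k m'
    omega
  obtain ⟨hodd, hge, hA, hmax⟩ := neIdx_spec hk hkpos h0
  rcases h1.lt_or_eq with hlt | heq
  · omega
  have hnj : j ≠ neIdx k m := by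
    rintro rfl
    exact hne (by rw [EtilNeg_eq_lowerAt, if_neg h0, ← h])
  have hrho : rho k j < rho k (neIdx k m) :=
    lt_of_le_of_ne (hmax j hj hkj heq) fun hr => hnj (rho_injOn hkj hge hr)
  have h3 := Aneg_le_epsNeg m' hodd hge
  rw [h, Aneg_lowerAt_of_rho_lt hk m hj hkj hodd hge hrho, ← h] at h3
  omega

lemma Aneg_self_of_odd (ho : Odd (m (-k + 2, k)))
    (h : m' = m - sg (-k) k + sg (-k + 2) k) : Aneg k m' k = Aneg k m k - 3 := by
  have h1 : Even (m (-k + 2, k) + 1) := ho.add_one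
  subst h
  rw [Aneg_self, Aneg_self]
  simp_all [rowSum_add, rowSum_sub, rowSum_sg, sg_apply]
  grind

lemma Aneg_self_of_not_odd (ho : ¬ Odd (m (-k + 2, k)))
    (h : m' = m - sg (-k + 2) k + (if k ≠ 1 then sg (-k + 2) (k - 2) else 0)) :
    Aneg k m' k = Aneg k m k + 1 := by
  subst h
  rw [Aneg_self, Aneg_self]
  split_ifs <;> simp_all [rowSum_add, rowSum_sub, rowSum_sg, sg_apply]
  grind

lemma Eco_ord_bound (hk : Odd k) (hkpos : 0 < k) (hm : ∀ p, 0 ≤ m p)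
    (hne : EtilNeg k m ≠ some m') :
    ordGT (Eco k m m') (-((epsNeg k m : ℝ) + (epsNeg k m' : ℝ) - 1) / 2) ∨
      ∃ o, HasLeadExp (Eco k m m') o ∧ 1 - epsNeg k m - epsNeg k m' ≤ 2 * o ∧
        (epsNeg k m ≤ epsNeg k m' + 1 → m ∉ Bpp k) := by
  have hkk : -k + 2 ≤ k := by grind
  have h1 := Aneg_le_epsNeg m hk hkk
  have h2 := Aneg_le_epsNeg m' hk hkk
  rcases Eco_eq_zero_or (m := m) (m' := m') hk hkpos with h | ⟨j, hj, hkj, h⟩ | ⟨ho, h⟩ | ⟨ho, h⟩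
  · exact Or.inl (h ▸ ordGT_zero _)
  · have hlead := hasLeadExp_Eco_lowerAt hk hkpos hm hj hkj
    rw [← h] at hlead
    have := two_mul_Aneg_lt_of_eq_lowerAt hk hkpos hj hkj h hne
    exact Or.inl (hlead.ordGT (by omega))
  · have hlead := hasLeadExp_Eco_self hkpos hm h
    rw [if_pos ho] at hlead
    rw [Aneg_self_of_odd ho h] at h2
    by_cases hle : epsNeg k m ≤ epsNeg k m' + 1
    · exact Or.inl (hlead.ordGT (by omega))
    · exact Or.inr ⟨_, hlead, by omega, fun h' => absurd h' hle⟩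
  · have hlead := hasLeadExp_Eco_flip hm h
    rw [if_neg ho] at hlead
    rw [Aneg_self_of_not_odd ho h] at h2
    rcases h1.lt_or_eq with hlt | heq
    · exact Or.inl (hlead.ordGT (by omega))
    · refine Or.inr ⟨_, hlead, by omega, fun _ hB => ?_⟩
      rcases hB.2 with ⟨h0, hge, hle⟩ | h'
      · have := (neIdx_spec hk hkpos h0).2.2.2 k hk hkk heq
        rw [rho_of_le le_rfl, rho_of_lt (by omega)] at this
        omega
      · exact ho h'

end Bounds

/-- Proposition 4.13 of Enomoto–Kashiwara: order estimates for the coefficients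
`E^{−k}_{m,m'}`.  Here `l = ε_{−k}(m)` and `l' = ε_{−k}(m')`. -/
theorem E_coefficient_estimates (k : ℤ) (hk : Odd k) (hkpos : 0 < k)
    (m m' : MS) (hm : IsTheta m) (hm' : IsTheta m') :
    (EtilNeg k m = some m' → inUnitBall (Eco k m m') (1 - epsNeg k m)) ∧
    (EtilNeg k m ≠ some m' →
      ordGE (Eco k m m') (-((epsNeg k m : ℝ) + (epsNeg k m' : ℝ) - 1) / 2)) ∧
    (EtilNeg k m ≠ some m' → epsNeg k m ≤ epsNeg k m' + 1 →
      ordEQ (Eco k m m') (-((epsNeg k m : ℝ) + (epsNeg k m' : ℝ) - 1) / 2) →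
      m ∉ Bpp k) := by
  have hp : ∀ p, 0 ≤ m p := fun p => hm.nonneg p
  refine ⟨fun h => ?_, fun hne => ?_, fun hne hle heq => ?_⟩
  · rw [EtilNeg_eq_lowerAt] at h
    split_ifs at h with h0
    obtain ⟨hodd, hge, hA, -⟩ := neIdx_spec hk hkpos h0
    rw [← hA, ← Option.some.inj h]
    exact (hasLeadExp_Eco_lowerAt hk hkpos hp hodd hge).inUnitBall
  · rcases Eco_ord_bound hk hkpos hp hne with h | ⟨o, ho, hb, -⟩
    · exact h.ordGE
    · refine ⟨o, ?_, ho.mem_Azero⟩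
      have : (1 - (epsNeg k m : ℝ) - epsNeg k m') ≤ 2 * o := by exact_mod_cast hb
      linarith
  · rcases Eco_ord_bound hk hkpos hp hne with h | ⟨o, -, -, hB⟩
    · exact absurd h heq.2
    · exact hB hle

end
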